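/- arXiv:1405.2502 — 2 statements merged into one kernel-verified Lean document; each statement's English description precedes it below -/
import Mathlib

section
/- For all bipartite density matrices ρ_AB on ℂ^{d_A} ⊗ ℂ^{d_B} and σ_{A'B'} on ℂ^{d_{A'}} ⊗ ℂ^{d_{B'}}, the maximal correlation of the tensor product state (with the AA' systems on one side and the BB' systems on the other) satisfies μ(ρ_AB ⊗ σ_{A'B'}) = max{ μ(ρ_AB), μ(σ_{A'B'}) }. -/
open scoped Matrix Kronecker ComplexOrder
open Matrix

noncomputable section

/-- Partial trace over the second (B) system. -/
def ptrB {A B : Type*} [Fintype B] (ρ : Matrix (A × B) (A × B) ℂ) : Matrix A A ℂ :=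
  fun i j => ∑ k, ρ (i, k) (j, k)

/-- Partial trace over the first (A) system. -/
def ptrA {A B : Type*} [Fintype A] (ρ : Matrix (A × B) (A × B) ℂ) : Matrix B B ℂ :=
  fun k l => ∑ i, ρ (i, k) (i, l)

/-- A density matrix: positive semidefinite with trace one. -/
def IsDensity {n : Type*} [Fintype n] (ρ : Matrix n n ℂ) : Prop :=
  ρ.PosSemidef ∧ ρ.trace = 1

/-- Maximal correlation of a bipartite state. -/
def mu {A B : Type*} [Fintype A] [Fintype B] (ρ : Matrix (A × B) (A × B) ℂ) : ℝ :=
  sSup {r : ℝ | ∃ (X : Matrix A A ℂ) (Y : Matrix B B ℂ),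
    ((ptrB ρ) * X).trace = 0 ∧ ((ptrA ρ) * Y).trace = 0 ∧
    ((ptrB ρ) * (X * Xᴴ)).trace = 1 ∧ ((ptrA ρ) * (Y * Yᴴ)).trace = 1 ∧
    r = ‖(ρ * (X ⊗ₖ Yᴴ)).trace‖}

/-- Maximal entanglement: infimum over finite decompositions of the max correlation. -/
def muEnt {A B : Type*} [Fintype A] [Fintype B] (ρ : Matrix (A × B) (A × B) ℂ) : ℝ :=
  sInf {r : ℝ | ∃ (m : ℕ) (p : Fin m → ℝ) (τ : Fin m → Matrix (A × B) (A × B) ℂ),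
    (∀ i, 0 ≤ p i) ∧ (∑ i, p i) = 1 ∧ (∀ i, IsDensity (τ i)) ∧
    ρ = ∑ i, p i • τ i ∧ r = ⨆ i, mu (τ i)}

/-- Application of a product channel given by local Kraus operators. -/
def applyLocal {A B A' B' ι κ : Type*} [Fintype A] [Fintype B] [Fintype ι] [Fintype κ]
    (K : ι → Matrix A' A ℂ) (L : κ → Matrix B' B ℂ)
    (ρ : Matrix (A × B) (A × B) ℂ) : Matrix (A' × B') (A' × B') ℂ :=
  ∑ k, ∑ m, (K k ⊗ₖ L m) * ρ * (K k ⊗ₖ L m)ᴴ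

/-- Tensor product of two bipartite states, with the A-systems grouped together. -/
def prodState {A B A' B' : Type*}
    (ρ : Matrix (A × B) (A × B) ℂ) (σ : Matrix (A' × B') (A' × B') ℂ) :
    Matrix ((A × A') × (B × B')) ((A × A') × (B × B')) ℂ :=
  fun x y => ρ (x.1.1, x.2.1) (y.1.1, y.2.1) * σ (x.1.2, x.2.2) (y.1.2, y.2.2)

/-- n-fold tensor power of a bipartite state, with all A-systems grouped together. -/
def powState {A B : Type*} (ρ : Matrix (A × B) (A × B) ℂ) (n : ℕ) :
    Matrix ((Fin n → A) × (Fin n → B)) ((Fin n → A) × (Fin n → B)) ℂ :=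
  fun x y => ∏ i, ρ (x.1 i, x.2 i) (y.1 i, y.2 i)

/-- The two-qubit Bell vector (|00⟩+|11⟩)/√2. -/
def bellVec : Fin 2 × Fin 2 → ℂ := fun p => if p.1 = p.2 then 1 / (Real.sqrt 2 : ℂ) else 0

/-- The positive semidefinite square root of a positive semidefinite matrix
(the definition of the older Mathlib, since removed there). -/
def Matrix.PosSemidef.sqrt {n 𝕜 : Type*} [Fintype n] [RCLike 𝕜] [DecidableEq n]
    {A : Matrix n n 𝕜} (hA : A.PosSemidef) : Matrix n n 𝕜 :=
  hA.1.eigenvectorUnitary.1 * diagonal ((↑) ∘ Real.sqrt ∘ hA.1.eigenvalues) *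
    (star hA.1.eigenvectorUnitary : Matrix n n 𝕜)

/-- Inverse of the positive semidefinite square root. -/
def invSqrt {n : Type*} [Fintype n] [DecidableEq n] (M : Matrix n n ℂ) : Matrix n n ℂ :=
  letI := Classical.dec M.PosSemidef
  if h : M.PosSemidef then h.sqrt⁻¹ else 0


section

variable {A B A' B' : Type*}

lemma ptrB_prodState [Fintype B] [Fintype B']
    (ρ : Matrix (A × B) (A × B) ℂ) (σ : Matrix (A' × B') (A' × B') ℂ) :
    ptrB (prodState ρ σ) = ptrB ρ ⊗ₖ ptrB σ := by
  ext i j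
  simp [ptrB, prodState, Fintype.sum_prod_type, Finset.sum_mul_sum]

lemma ptrA_prodState [Fintype A] [Fintype A']
    (ρ : Matrix (A × B) (A × B) ℂ) (σ : Matrix (A' × B') (A' × B') ℂ) :
    ptrA (prodState ρ σ) = ptrA ρ ⊗ₖ ptrA σ := by
  ext i j
  simp [ptrA, prodState, Fintype.sum_prod_type, Finset.sum_mul_sum]

lemma prodState_eq_submatrix
    (ρ : Matrix (A × B) (A × B) ℂ) (σ : Matrix (A' × B') (A' × B') ℂ) :
    prodState ρ σ =
      (ρ ⊗ₖ σ).submatrix (Equiv.prodProdProdComm A A' B B') (Equiv.prodProdProdComm A A' B B') :=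
  rfl

lemma Matrix.IsHermitian.ptrB [Fintype B] {ρ : Matrix (A × B) (A × B) ℂ} (h : ρ.IsHermitian) :
    (ptrB ρ).IsHermitian := by
  ext i j
  simp [_root_.ptrB, conjTranspose_apply, h.apply]

lemma Matrix.IsHermitian.ptrA [Fintype A] {ρ : Matrix (A × B) (A × B) ℂ} (h : ρ.IsHermitian) :
    (ptrA ρ).IsHermitian := by
  ext i j
  simp [_root_.ptrA, conjTranspose_apply, h.apply]

lemma trace_mul_eq_sum {n : Type*} [Fintype n] (M X : Matrix n n ℂ) :
    (M * X).trace = ∑ q : n × n, M q.2 q.1 * X q.1 q.2 := by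
  simp [trace, mul_apply, Fintype.sum_prod_type_right]

variable [Fintype A] [Fintype B] [Fintype A'] [Fintype B']

lemma trace_submatrix_equiv {m n : Type*} [Fintype m] [Fintype n] (M : Matrix n n ℂ) (e : m ≃ n) :
    (M.submatrix e e).trace = M.trace :=
  e.sum_comp fun i => M i i

lemma trace_prodState_mul
    (ρ : Matrix (A × B) (A × B) ℂ) (σ : Matrix (A' × B') (A' × B') ℂ)
    (X : Matrix A A ℂ) (X' : Matrix A' A' ℂ) (Y : Matrix B B ℂ) (Y' : Matrix B' B' ℂ) :
    (prodState ρ σ * ((X ⊗ₖ X') ⊗ₖ (Y ⊗ₖ Y'))).trace =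
      (ρ * (X ⊗ₖ Y)).trace * (σ * (X' ⊗ₖ Y')).trace := by
  have h : (X ⊗ₖ X') ⊗ₖ (Y ⊗ₖ Y') = ((X ⊗ₖ Y) ⊗ₖ (X' ⊗ₖ Y')).submatrix
      (Equiv.prodProdProdComm A A' B B') (Equiv.prodProdProdComm A A' B B') := by
    ext i j
    simp [Equiv.prodProdProdComm]
    ring
  rw [h, prodState_eq_submatrix, submatrix_mul_equiv, ← mul_kronecker_mul, trace_submatrix_equiv, trace_kronecker]

lemma trace_prodState
    (ρ : Matrix (A × B) (A × B) ℂ) (σ : Matrix (A' × B') (A' × B') ℂ) :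
    (prodState ρ σ).trace = ρ.trace * σ.trace := by
  rw [prodState_eq_submatrix, trace_submatrix_equiv, trace_kronecker]

lemma IsDensity.prodState {ρ : Matrix (A × B) (A × B) ℂ} {σ : Matrix (A' × B') (A' × B') ℂ}
    (hρ : IsDensity ρ) (hσ : IsDensity σ) : IsDensity (prodState ρ σ) := by
  refine ⟨?_, by rw [trace_prodState, hρ.2, hσ.2, one_mul]⟩
  rw [prodState_eq_submatrix]
  exact (hρ.1.kronecker hσ.1).submatrix _

lemma trace_ptrB (ρ : Matrix (A × B) (A × B) ℂ) : (ptrB ρ).trace = ρ.trace := by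
  simp [trace, ptrB, Fintype.sum_prod_type]

lemma trace_ptrA (ρ : Matrix (A × B) (A × B) ℂ) : (ptrA ρ).trace = ρ.trace := by
  simp [trace, ptrA, Fintype.sum_prod_type_right]

lemma trace_mul_kronecker_one [DecidableEq B] (ρ : Matrix (A × B) (A × B) ℂ)
    (X : Matrix A A ℂ) : (ρ * (X ⊗ₖ (1 : Matrix B B ℂ))).trace = (ptrB ρ * X).trace := by
  simp [trace, mul_apply, ptrB, Fintype.sum_prod_type, one_apply, Finset.sum_mul]
  exact Finset.sum_congr rfl fun _ _ => Finset.sum_comm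

lemma trace_mul_one_kronecker [DecidableEq A] (ρ : Matrix (A × B) (A × B) ℂ)
    (Y : Matrix B B ℂ) : (ρ * ((1 : Matrix A A ℂ) ⊗ₖ Y)).trace = (ptrA ρ * Y).trace := by
  simp [trace, mul_apply, ptrA, Fintype.sum_prod_type_right, one_apply, Finset.sum_mul]
  exact Finset.sum_congr rfl fun _ _ => Finset.sum_comm

/-- The linear functional `X ↦ tr (ρ_A X)`, `Y ↦ tr (ρ_B Y)` in coordinates. -/
def meanVec (ρ : Matrix (A × B) (A × B) ℂ) : (A × A) ⊕ (B × B) → ℂ :=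
  Sum.elim (fun p => ptrB ρ p.2 p.1) (fun p => ptrA ρ p.2 p.1)

/-- The matrix of the sesquilinear form `(X, Y) ↦ tr (ρ (X ⊗ Yᴴ)) - tr (ρ_A X) conj (tr (ρ_B Y))`. -/
def crossCov (ρ : Matrix (A × B) (A × B) ℂ) : Matrix (B × B) (A × A) ℂ :=
  of fun p q => ρ (q.2, p.1) (q.1, p.2) - star (ptrA ρ p.2 p.1) * ptrB ρ q.2 q.1

/-- The matrix of the covariance form `X ↦ tr (M X Xᴴ) - |tr (M X)|²`. -/
def covMatrix {n : Type*} [DecidableEq n] (M : Matrix n n ℂ) : Matrix (n × n) (n × n) ℂ :=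
  of fun p q => M p.1 q.1 * (1 : Matrix n n ℂ) p.2 q.2 - star (M p.2 p.1) * M q.2 q.1

/-- The block covariance matrix of `ρ`, with diagonal blocks scaled by `c`. It is positive
semidefinite iff the maximal correlation of `ρ` is at most `c`. -/
def blockCov [DecidableEq A] [DecidableEq B] (ρ : Matrix (A × B) (A × B) ℂ) (c : ℝ) :
    Matrix ((A × A) ⊕ (B × B)) ((A × A) ⊕ (B × B)) ℂ :=
  fromBlocks ((c : ℂ) • covMatrix (ptrB ρ)) (crossCov ρ)ᴴ (crossCov ρ)
    ((c : ℂ) • covMatrix (ptrA ρ))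

lemma star_dotProduct_crossCov_mulVec (ρ : Matrix (A × B) (A × B) ℂ)
    (X : Matrix A A ℂ) (Y : Matrix B B ℂ) :
    star (fun p : B × B => Y p.1 p.2) ⬝ᵥ (crossCov ρ *ᵥ fun p => X p.1 p.2) =
      (ρ * (X ⊗ₖ Yᴴ)).trace - star (ptrA ρ * Y).trace * (ptrB ρ * X).trace := by
  have h1 : (ρ * (X ⊗ₖ Yᴴ)).trace =
      ∑ p : B × B, ∑ q : A × A, star (Y p.1 p.2) * ρ (q.2, p.1) (q.1, p.2) * X q.1 q.2 := by
    simp only [trace, mul_apply, diag_apply, kroneckerMap_apply, conjTranspose_apply]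
    rw [← Finset.sum_product', ← Finset.sum_product']
    refine Finset.sum_bij' (fun x _ => ((x.1.2, x.2.2), (x.2.1, x.1.1)))
      (fun x _ => ((x.2.2, x.1.1), (x.2.1, x.1.2))) ?_ ?_ ?_ ?_ ?_ <;> simp
    intros; ring
  rw [h1, trace_mul_eq_sum (ptrA ρ), trace_mul_eq_sum (ptrB ρ), star_sum, Finset.sum_mul_sum, ← Finset.sum_sub_distrib]
  simp only [← Finset.sum_sub_distrib, dotProduct, mulVec, Finset.mul_sum, crossCov, of_apply,
    Pi.star_apply, star_mul']
  exact Finset.sum_congr rfl fun _ _ => Finset.sum_congr rfl fun _ _ => by ring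

lemma trace_ptrB_mul_self_nonneg [DecidableEq B] {ρ : Matrix (A × B) (A × B) ℂ} (hρ : IsDensity ρ)
    (X : Matrix A A ℂ) : 0 ≤ (ptrB ρ * (X * Xᴴ)).trace := by
  rw [← trace_mul_kronecker_one, show (X * Xᴴ) ⊗ₖ (1 : Matrix B B ℂ) =
    (X ⊗ₖ (1 : Matrix B B ℂ)) * (X ⊗ₖ (1 : Matrix B B ℂ))ᴴ by
      simp [conjTranspose_kronecker, ← mul_kronecker_mul], ← mul_assoc, trace_mul_comm, ← mul_assoc]
  exact (hρ.1.conjTranspose_mul_mul_same _).trace_nonneg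

lemma trace_ptrA_mul_self_nonneg [DecidableEq A] {ρ : Matrix (A × B) (A × B) ℂ} (hρ : IsDensity ρ)
    (Y : Matrix B B ℂ) : 0 ≤ (ptrA ρ * (Y * Yᴴ)).trace := by
  rw [← trace_mul_one_kronecker, show (1 : Matrix A A ℂ) ⊗ₖ (Y * Yᴴ) =
    ((1 : Matrix A A ℂ) ⊗ₖ Y) * ((1 : Matrix A A ℂ) ⊗ₖ Y)ᴴ by
      simp [conjTranspose_kronecker, ← mul_kronecker_mul], ← mul_assoc, trace_mul_comm, ← mul_assoc]
  exact (hρ.1.conjTranspose_mul_mul_same _).trace_nonneg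

lemma mu_nonneg (ρ : Matrix (A × B) (A × B) ℂ) : 0 ≤ mu ρ :=
  Real.sSup_nonneg fun _ ⟨_, _, _, _, _, _, h⟩ => h ▸ norm_nonneg _

variable [DecidableEq A] [DecidableEq B] [DecidableEq A'] [DecidableEq B']

lemma blockCov_prodState {ρ : Matrix (A × B) (A × B) ℂ} {σ : Matrix (A' × B') (A' × B') ℂ}
    (c : ℝ) :
    blockCov (prodState ρ σ) c =
      (blockCov ρ c ⊗ₖ blockCov σ 1
        + blockCov ρ c ⊗ₖ vecMulVec (star (meanVec σ)) (meanVec σ)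
        + vecMulVec (star (meanVec ρ)) (meanVec ρ) ⊗ₖ blockCov σ c).submatrix
        (Sum.elim (fun p => (.inl (p.1.1, p.2.1), .inl (p.1.2, p.2.2)))
          (fun p => (.inr (p.1.1, p.2.1), .inr (p.1.2, p.2.2))))
        (Sum.elim (fun p => (.inl (p.1.1, p.2.1), .inl (p.1.2, p.2.2)))
          (fun p => (.inr (p.1.1, p.2.1), .inr (p.1.2, p.2.2)))) := by
  have h1 (i j : A × A') : (1 : Matrix (A × A') (A × A') ℂ) i j
      = (1 : Matrix A A ℂ) i.1 j.1 * (1 : Matrix A' A' ℂ) i.2 j.2 := by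
    rw [← one_kronecker_one]; rfl
  have h2 (i j : B × B') : (1 : Matrix (B × B') (B × B') ℂ) i j
      = (1 : Matrix B B ℂ) i.1 j.1 * (1 : Matrix B' B' ℂ) i.2 j.2 := by
    rw [← one_kronecker_one]; rfl
  ext (p | p) (q | q) <;>
    simp [blockCov, covMatrix, crossCov, meanVec, ptrB_prodState, ptrA_prodState, vecMulVec_apply,
      h1, h2, prodState] <;> ring

lemma Matrix.PosSemidef.blockCov_prodState {ρ : Matrix (A × B) (A × B) ℂ}
    {σ : Matrix (A' × B') (A' × B') ℂ} {c : ℝ} (hρ : (blockCov ρ c).PosSemidef)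
    (hσ : (blockCov σ c).PosSemidef) (hσ' : (blockCov σ 1).PosSemidef) :
    (blockCov (prodState ρ σ) c).PosSemidef := by
  rw [_root_.blockCov_prodState]
  exact (((hρ.kronecker hσ').add (hρ.kronecker (posSemidef_vecMulVec_star_self _))).add
    ((posSemidef_vecMulVec_star_self _).kronecker hσ)).submatrix _

lemma star_dotProduct_covMatrix_mulVec {n : Type*} [Fintype n] [DecidableEq n]
    (M X : Matrix n n ℂ) :
    star (fun p : n × n => X p.1 p.2) ⬝ᵥ (covMatrix M *ᵥ fun p => X p.1 p.2) =
      (M * (X * Xᴴ)).trace - star (M * X).trace * (M * X).trace := by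
  have h1 : (M * (X * Xᴴ)).trace =
      ∑ p : n × n, ∑ q : n × n, star (X p.1 p.2) * (M p.1 q.1 * (1 : Matrix n n ℂ) p.2 q.2) *
        X q.1 q.2 := by
    simp [trace, mul_apply, Fintype.sum_prod_type, one_apply, Finset.mul_sum]
    refine Finset.sum_congr rfl fun i _ => ?_
    rw [Finset.sum_comm]
    exact Finset.sum_congr rfl fun _ _ => Finset.sum_congr rfl fun _ _ => by ring
  rw [h1, trace_mul_eq_sum, star_sum, Finset.sum_mul_sum, ← Finset.sum_sub_distrib]
  simp only [← Finset.sum_sub_distrib, dotProduct, mulVec, Finset.mul_sum, covMatrix, of_apply,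
    Pi.star_apply, star_mul']
  exact Finset.sum_congr rfl fun _ _ => Finset.sum_congr rfl fun _ _ => by ring

lemma star_dotProduct_blockCov_mulVec (ρ : Matrix (A × B) (A × B) ℂ) (c : ℝ)
    (X : Matrix A A ℂ) (Y : Matrix B B ℂ) :
    star (Sum.elim (fun p : A × A => X p.1 p.2) fun p : B × B => Y p.1 p.2) ⬝ᵥ
        (blockCov ρ c *ᵥ Sum.elim (fun p : A × A => X p.1 p.2) fun p : B × B => Y p.1 p.2) =
      c * ((ptrB ρ * (X * Xᴴ)).trace - star (ptrB ρ * X).trace * (ptrB ρ * X).trace)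
      + c * ((ptrA ρ * (Y * Yᴴ)).trace - star (ptrA ρ * Y).trace * (ptrA ρ * Y).trace)
      + ((ρ * (X ⊗ₖ Yᴴ)).trace - star (ptrA ρ * Y).trace * (ptrB ρ * X).trace)
      + star ((ρ * (X ⊗ₖ Yᴴ)).trace - star (ptrA ρ * Y).trace * (ptrB ρ * X).trace) := by
  rw [← star_dotProduct_crossCov_mulVec, ← star_dotProduct_covMatrix_mulVec,
    ← star_dotProduct_covMatrix_mulVec, blockCov, fromBlocks_mulVec, Function.star_sumElim,
    sumElim_dotProduct_sumElim]
  set x := fun p : A × A => X p.1 p.2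
  set y := fun p : B × B => Y p.1 p.2
  have h : star x ⬝ᵥ ((crossCov ρ)ᴴ *ᵥ y) = star (star y ⬝ᵥ (crossCov ρ *ᵥ x)) := by
    rw [star_dotProduct, star_mulVec, conjTranspose_conjTranspose, ← dotProduct_mulVec,
      dotProduct_comm]
  simp only [Sum.elim_comp_inl, Sum.elim_comp_inr, dotProduct_add, smul_mulVec, dotProduct_smul,
    smul_eq_mul, h]
  ring

lemma trace_mul_sub_smul_one {n : Type*} [Fintype n] [DecidableEq n] {M : Matrix n n ℂ}
    (hM : M.IsHermitian) (htr : M.trace = 1) (X : Matrix n n ℂ) :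
    (M * ((X - (M * X).trace • (1 : Matrix n n ℂ)) *
      (X - (M * X).trace • (1 : Matrix n n ℂ))ᴴ)).trace =
      (M * (X * Xᴴ)).trace - star (M * X).trace * (M * X).trace := by
  have h : (M * Xᴴ).trace = star (M * X).trace := by
    rw [← trace_conjTranspose, conjTranspose_mul, hM.eq, trace_mul_comm]
  simp [mul_sub, sub_mul, htr, h, mul_comm]

lemma isHermitian_covMatrix {n : Type*} [DecidableEq n] {M : Matrix n n ℂ}
    (hM : M.IsHermitian) : (covMatrix M).IsHermitian := by
  ext p q
  have h1 : (1 : Matrix n n ℂ) q.2 p.2 = (1 : Matrix n n ℂ) p.2 q.2 := by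
    simp [one_apply, eq_comm]
  have h2 : star ((1 : Matrix n n ℂ) p.2 q.2) = (1 : Matrix n n ℂ) p.2 q.2 := by
    rw [one_apply]; split_ifs <;> simp
  simp only [conjTranspose_apply, covMatrix, of_apply, star_sub, star_mul', hM.apply,
    h1, h2]
  ring

lemma isHermitian_blockCov {ρ : Matrix (A × B) (A × B) ℂ} (hρ : ρ.IsHermitian) (c : ℝ) :
    (blockCov ρ c).IsHermitian :=
  .fromBlocks ((isHermitian_covMatrix hρ.ptrB).smul (Complex.conj_ofReal c))
    (conjTranspose_conjTranspose _)
    ((isHermitian_covMatrix hρ.ptrA).smul (Complex.conj_ofReal c))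

lemma posSemidef_blockCov_iff {ρ : Matrix (A × B) (A × B) ℂ} (hρ : IsDensity ρ) (c : ℝ) :
    (blockCov ρ c).PosSemidef ↔ ∀ (X : Matrix A A ℂ) (Y : Matrix B B ℂ),
      (ptrB ρ * X).trace = 0 → (ptrA ρ * Y).trace = 0 →
      0 ≤ c * (ptrB ρ * (X * Xᴴ)).trace + c * (ptrA ρ * (Y * Yᴴ)).trace
        + (ρ * (X ⊗ₖ Yᴴ)).trace + star (ρ * (X ⊗ₖ Yᴴ)).trace := by
  constructor
  · intro h X Y hX hY
    have := h.dotProduct_mulVec_nonneg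
      (Sum.elim (fun p : A × A => X p.1 p.2) fun p : B × B => Y p.1 p.2)
    rw [star_dotProduct_blockCov_mulVec] at this
    simpa [hX, hY] using this
  · intro h
    refine .of_dotProduct_mulVec_nonneg (isHermitian_blockCov hρ.1.1 c) fun v => ?_
    have hv : v = Sum.elim (fun p : A × A => (of fun i j => v (.inl (i, j)) : Matrix A A ℂ) p.1 p.2)
        fun p : B × B => (of fun i j => v (.inr (i, j)) : Matrix B B ℂ) p.1 p.2 := by
      ext (p | p) <;> rfl
    generalize (of fun i j => v (.inl (i, j)) : Matrix A A ℂ) = X at hv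
    generalize (of fun i j => v (.inr (i, j)) : Matrix B B ℂ) = Y at hv
    have hA : (ptrB ρ).trace = 1 := by rw [trace_ptrB, hρ.2]
    have hB : (ptrA ρ).trace = 1 := by rw [trace_ptrA, hρ.2]
    have hX : (ptrB ρ * (X - (ptrB ρ * X).trace • (1 : Matrix A A ℂ))).trace = 0 := by
      simp [mul_sub, hA]
    have hY : (ptrA ρ * (Y - (ptrA ρ * Y).trace • (1 : Matrix B B ℂ))).trace = 0 := by
      simp [mul_sub, hB]
    have h1 : (ptrA ρ * Yᴴ).trace = star (ptrA ρ * Y).trace := by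
      rw [← trace_conjTranspose, conjTranspose_mul, hρ.1.1.ptrA.eq, trace_mul_comm]
    have hXY : (ρ * ((X - (ptrB ρ * X).trace • (1 : Matrix A A ℂ)) ⊗ₖ
        (Y - (ptrA ρ * Y).trace • (1 : Matrix B B ℂ))ᴴ)).trace =
        (ρ * (X ⊗ₖ Yᴴ)).trace - star (ptrA ρ * Y).trace * (ptrB ρ * X).trace := by
      simp [sub_eq_add_neg, ← neg_smul, add_kronecker, kronecker_add, smul_kronecker,
        kronecker_smul, mul_add, trace_mul_kronecker_one, trace_mul_one_kronecker, hρ.2, h1]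
      ring
    have key := h _ _ hX hY
    rw [trace_mul_sub_smul_one hρ.1.1.ptrB hA, trace_mul_sub_smul_one hρ.1.1.ptrA hB, hXY] at key
    rwa [hv, star_dotProduct_blockCov_mulVec]

lemma posSemidef_blockCov_one {ρ : Matrix (A × B) (A × B) ℂ} (hρ : IsDensity ρ) :
    (blockCov ρ 1).PosSemidef := by
  rw [posSemidef_blockCov_iff hρ]
  intro X Y _ _
  set U : Matrix (A × B) (A × B) ℂ := X ⊗ₖ 1 + 1 ⊗ₖ Y with hU
  have h1 : (ρ * (Xᴴ ⊗ₖ Y)).trace = star (ρ * (X ⊗ₖ Yᴴ)).trace := by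
    rw [← trace_conjTranspose, conjTranspose_mul, hρ.1.1.eq, trace_mul_comm,
      conjTranspose_kronecker, conjTranspose_conjTranspose]
  have h2 : 0 ≤ (ρ * (U * Uᴴ)).trace := by
    rw [← mul_assoc, trace_mul_comm, ← mul_assoc]
    exact (hρ.1.conjTranspose_mul_mul_same U).trace_nonneg
  convert! h2 using 1
  simp [hU, conjTranspose_kronecker, add_mul, mul_add, ← mul_kronecker_mul,
    trace_mul_kronecker_one, trace_mul_one_kronecker, h1]
  ring

lemma norm_trace_sq_le {ρ : Matrix (A × B) (A × B) ℂ} (hρ : IsDensity ρ) {c : ℝ}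
    (hc : (blockCov ρ c).PosSemidef) {X : Matrix A A ℂ} {Y : Matrix B B ℂ}
    (hX : (ptrB ρ * X).trace = 0) (hY : (ptrA ρ * Y).trace = 0) :
    ‖(ρ * (X ⊗ₖ Yᴴ)).trace‖ ^ 2 ≤
      c ^ 2 * (ptrB ρ * (X * Xᴴ)).trace.re * (ptrA ρ * (Y * Yᴴ)).trace.re := by
  set z := (ρ * (X ⊗ₖ Yᴴ)).trace with hz
  set s := (ptrB ρ * (X * Xᴴ)).trace with hs
  set t := (ptrA ρ * (Y * Yᴴ)).trace with ht
  have hd := discrim_le_zero (a := c * s.re * ‖z‖ ^ 2) (b := 2 * ‖z‖ ^ 2) (c := c * t.re) ?_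
  · by_cases h0 : ‖z‖ = 0
    · have := (trace_ptrB_mul_self_nonneg hρ X).1
      have := (trace_ptrA_mul_self_nonneg hρ Y).1
      rw [h0, zero_pow two_ne_zero]
      simp only [Complex.zero_re] at *
      positivity
    · have : 0 < ‖z‖ ^ 2 := by positivity
      rw [discrim] at hd
      have : ‖z‖ ^ 2 * (‖z‖ ^ 2 - c ^ 2 * s.re * t.re) ≤ 0 := by nlinarith
      nlinarith [nonpos_of_mul_nonpos_right this ‹_›]
  · intro r
    have h := ((posSemidef_blockCov_iff hρ c).1 hc (((r : ℂ) * star z) • X) Y (by simp [hX]) hY).1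
    have e1 : (ptrB ρ * ((((r : ℂ) * star z) • X) * (((r : ℂ) * star z) • X)ᴴ)).trace =
        ((r ^ 2 * ‖z‖ ^ 2 : ℝ) : ℂ) * s := by
      push_cast
      rw [← Complex.conj_mul' z]
      simp [hs]
      ring
    have e2 : (ρ * ((((r : ℂ) * star z) • X) ⊗ₖ Yᴴ)).trace = ((r * ‖z‖ ^ 2 : ℝ) : ℂ) := by
      push_cast
      rw [← Complex.conj_mul' z]
      simp [smul_kronecker, ← hz]
      ring
    rw [e1, e2, ← ht] at h
    simp only [Complex.add_re, Complex.re_ofReal_mul, Complex.ofReal_re, Complex.zero_re,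
      Complex.star_def, Complex.conj_re] at h
    linarith

/-- The set of correlations whose supremum is `mu ρ`. -/
def correlations (ρ : Matrix (A × B) (A × B) ℂ) : Set ℝ :=
  {r : ℝ | ∃ (X : Matrix A A ℂ) (Y : Matrix B B ℂ),
    ((ptrB ρ) * X).trace = 0 ∧ ((ptrA ρ) * Y).trace = 0 ∧
    ((ptrB ρ) * (X * Xᴴ)).trace = 1 ∧ ((ptrA ρ) * (Y * Yᴴ)).trace = 1 ∧
    r = ‖(ρ * (X ⊗ₖ Yᴴ)).trace‖}

lemma le_of_mem_correlations {ρ : Matrix (A × B) (A × B) ℂ} (hρ : IsDensity ρ) {c : ℝ}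
    (h0 : 0 ≤ c) (hc : (blockCov ρ c).PosSemidef) {r : ℝ} (hr : r ∈ correlations ρ) : r ≤ c := by
  obtain ⟨X, Y, hX, hY, hXX, hYY, rfl⟩ := hr
  have := norm_trace_sq_le hρ hc hX hY
  rw [hXX, hYY] at this
  exact le_of_sq_le_sq (by simpa using this) h0

lemma bddAbove_correlations {ρ : Matrix (A × B) (A × B) ℂ} (hρ : IsDensity ρ) :
    BddAbove (correlations ρ) :=
  ⟨1, fun _ => le_of_mem_correlations hρ zero_le_one (posSemidef_blockCov_one hρ)⟩

lemma norm_trace_le_mu {ρ : Matrix (A × B) (A × B) ℂ} (hρ : IsDensity ρ)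
    {X : Matrix A A ℂ} {Y : Matrix B B ℂ}
    (hX : (ptrB ρ * X).trace = 0) (hY : (ptrA ρ * Y).trace = 0) :
    ‖(ρ * (X ⊗ₖ Yᴴ)).trace‖ ≤
      mu ρ * (√(ptrB ρ * (X * Xᴴ)).trace.re * √(ptrA ρ * (Y * Yᴴ)).trace.re) := by
  have hs := Complex.nonneg_iff.1 (trace_ptrB_mul_self_nonneg hρ X)
  have ht := Complex.nonneg_iff.1 (trace_ptrA_mul_self_nonneg hρ Y)
  have hle := norm_trace_sq_le hρ (posSemidef_blockCov_one hρ) hX hY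
  set z := (ρ * (X ⊗ₖ Yᴴ)).trace with hz
  obtain ⟨s, hs'⟩ : ∃ s : ℝ, (ptrB ρ * (X * Xᴴ)).trace = s := ⟨_, Complex.ext rfl hs.2.symm⟩
  obtain ⟨t, ht'⟩ : ∃ t : ℝ, (ptrA ρ * (Y * Yᴴ)).trace = t := ⟨_, Complex.ext rfl ht.2.symm⟩
  rw [hs', Complex.ofReal_re] at hs hle ⊢
  rw [ht', Complex.ofReal_re] at ht hle ⊢
  by_cases h0 : s = 0 ∨ t = 0
  · have : ‖z‖ ^ 2 ≤ 0 := by rcases h0 with h | h <;> simpa [h] using hle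
    have := pow_eq_zero_iff two_ne_zero |>.1 (le_antisymm this (sq_nonneg _))
    rw [this]
    exact mul_nonneg (mu_nonneg ρ) (by positivity)
  · push Not at h0
    have hsp : 0 < √s := Real.sqrt_pos.2 (lt_of_le_of_ne hs.1 h0.1.symm)
    have htp : 0 < √t := Real.sqrt_pos.2 (lt_of_le_of_ne ht.1 h0.2.symm)
    have hs2 : ((√s : ℝ) : ℂ)⁻¹ * ((√s : ℝ) : ℂ)⁻¹ * s = 1 := by
      norm_cast
      rw [← mul_inv, Real.mul_self_sqrt hs.1, inv_mul_cancel₀ h0.1]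
    have ht2 : ((√t : ℝ) : ℂ)⁻¹ * ((√t : ℝ) : ℂ)⁻¹ * t = 1 := by
      norm_cast
      rw [← mul_inv, Real.mul_self_sqrt ht.1, inv_mul_cancel₀ h0.2]
    have hmem : (√s)⁻¹ * (√t)⁻¹ * ‖z‖ ∈ correlations ρ := by
      refine ⟨((√s : ℝ) : ℂ)⁻¹ • X, ((√t : ℝ) : ℂ)⁻¹ • Y, by simp [hX], by simp [hY], ?_, ?_, ?_⟩
      · simpa [hs', mul_assoc] using hs2
      · simpa [ht', mul_assoc] using ht2
      · simp [smul_kronecker, kronecker_smul, ← hz, abs_of_pos hsp, abs_of_pos htp]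
        ring
    have := le_csSup (bddAbove_correlations hρ) hmem
    rwa [← mul_inv, inv_mul_le_iff₀ (by positivity), mul_comm] at this

lemma posSemidef_blockCov_of_mu_le {ρ : Matrix (A × B) (A × B) ℂ} (hρ : IsDensity ρ) {c : ℝ}
    (hc : mu ρ ≤ c) : (blockCov ρ c).PosSemidef := by
  rw [posSemidef_blockCov_iff hρ]
  intro X Y hX hY
  have hs := Complex.nonneg_iff.1 (trace_ptrB_mul_self_nonneg hρ X)
  have ht := Complex.nonneg_iff.1 (trace_ptrA_mul_self_nonneg hρ Y)
  have hle := norm_trace_le_mu hρ hX hY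
  have hre := Complex.abs_re_le_norm (ρ * (X ⊗ₖ Yᴴ)).trace
  generalize (ρ * (X ⊗ₖ Yᴴ)).trace = z at *
  generalize (ptrB ρ * (X * Xᴴ)).trace = s at *
  generalize (ptrA ρ * (Y * Yᴴ)).trace = t at *
  refine Complex.nonneg_iff.2 ⟨?_, by simp [← hs.2, ← ht.2]⟩
  simp only [Complex.add_re, Complex.re_ofReal_mul, Complex.star_def, Complex.conj_re]
  have h1 : ‖z‖ ≤ c * (√s.re * √t.re) := hle.trans (by gcongr)
  have h2 := mul_nonneg ((mu_nonneg ρ).trans hc) (sq_nonneg (√s.re - √t.re))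
  have h3 : c * (√s.re - √t.re) ^ 2 = c * s.re + c * t.re - 2 * (c * (√s.re * √t.re)) := by
    rw [sub_sq, Real.sq_sqrt hs.1, Real.sq_sqrt ht.1]
    ring
  linarith [neg_abs_le z.re]

lemma mu_prodState_le {ρ : Matrix (A × B) (A × B) ℂ} {σ : Matrix (A' × B') (A' × B') ℂ}
    (hρ : IsDensity ρ) (hσ : IsDensity σ) : mu (prodState ρ σ) ≤ max (mu ρ) (mu σ) :=
  have h0 := le_max_of_le_left (mu_nonneg ρ)
  Real.sSup_le (fun _ => le_of_mem_correlations (hρ.prodState hσ) h0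
    ((posSemidef_blockCov_of_mu_le hρ (le_max_left _ _)).blockCov_prodState
      (posSemidef_blockCov_of_mu_le hσ (le_max_right _ _)) (posSemidef_blockCov_one hσ))) h0

lemma mu_le_mu_prodState_left {ρ : Matrix (A × B) (A × B) ℂ} {σ : Matrix (A' × B') (A' × B') ℂ}
    (hρ : IsDensity ρ) (hσ : IsDensity σ) : mu ρ ≤ mu (prodState ρ σ) := by
  refine Real.sSup_le ?_ (mu_nonneg _)
  rintro _ ⟨X, Y, hX, hY, hXX, hYY, rfl⟩
  refine le_csSup (bddAbove_correlations (hρ.prodState hσ)) ⟨X ⊗ₖ 1, Y ⊗ₖ 1, ?_, ?_, ?_, ?_, ?_⟩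
  all_goals simp [ptrB_prodState, ptrA_prodState, conjTranspose_kronecker, ← mul_kronecker_mul,
    trace_kronecker, trace_prodState_mul, trace_ptrB, trace_ptrA, hσ.2, hX, hY, hXX, hYY]

lemma mu_le_mu_prodState_right {ρ : Matrix (A × B) (A × B) ℂ} {σ : Matrix (A' × B') (A' × B') ℂ}
    (hρ : IsDensity ρ) (hσ : IsDensity σ) : mu σ ≤ mu (prodState ρ σ) := by
  refine Real.sSup_le ?_ (mu_nonneg _)
  rintro _ ⟨X, Y, hX, hY, hXX, hYY, rfl⟩
  refine le_csSup (bddAbove_correlations (hρ.prodState hσ)) ⟨1 ⊗ₖ X, 1 ⊗ₖ Y, ?_, ?_, ?_, ?_, ?_⟩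
  all_goals simp [ptrB_prodState, ptrA_prodState, conjTranspose_kronecker, ← mul_kronecker_mul,
    trace_kronecker, trace_prodState_mul, trace_ptrB, trace_ptrA, hρ.2, hX, hY, hXX, hYY]

end

/-- Maximal correlation of a tensor product state is the max of the maximal correlations. -/
theorem mu_prodState {dA dB dA' dB' : ℕ}
    (ρ : Matrix (Fin dA × Fin dB) (Fin dA × Fin dB) ℂ)
    (σ : Matrix (Fin dA' × Fin dB') (Fin dA' × Fin dB') ℂ)
    (hρ : IsDensity ρ) (hσ : IsDensity σ) :
    mu (prodState ρ σ) = max (mu ρ) (mu σ) := by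
  exact le_antisymm (mu_prodState_le hρ hσ)
    (max_le (mu_le_mu_prodState_left hρ hσ) (mu_le_mu_prodState_right hρ hσ))
end
end

section
/- Let p be a joint probability distribution on {0,1} × {0,1} with entries p_{00}, p_{01}, p_{10}, p_{11}, whose marginals p_{00}+p_{01}, p_{10}+p_{11}, p_{00}+p_{10}, p_{01}+p_{11} are all strictly positive. Then the maximal correlation of p equals |p_{00} p_{11} − p_{01} p_{10}| / √((p_{00}+p_{01})(p_{10}+p_{11})(p_{00}+p_{10})(p_{01}+p_{11})). -/
open scoped Matrix Kronecker ComplexOrder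
open Matrix

noncomputable section

/-- Classical maximal correlation of a joint distribution. -/
def muC {A B : Type*} [Fintype A] [Fintype B] (p : A → B → ℝ) : ℝ :=
  sSup {r : ℝ | ∃ (f : A → ℝ) (g : B → ℝ),
    (∑ a, ∑ b, p a b * f a) = 0 ∧ (∑ a, ∑ b, p a b * g b) = 0 ∧
    (∑ a, ∑ b, p a b * (f a) ^ 2) = 1 ∧ (∑ a, ∑ b, p a b * (g b) ^ 2) = 1 ∧
    r = ∑ a, ∑ b, p a b * (f a * g b)}

/-- A centered binary variable with weights `s + t = 1` is determined by the difference of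
its two values. -/
theorem eq_mul_sub_of_centered {s t x y : ℝ} (hst : s + t = 1) (h : s * x + t * y = 0) :
    x = t * (x - y) ∧ y = -(s * (x - y)) :=
  ⟨by linear_combination h - x * hst, by linear_combination h - y * hst⟩

/-- Maximal correlation of a binary joint distribution with positive marginals. -/
theorem muC_binary (p : Fin 2 → Fin 2 → ℝ)
    (hpos : ∀ a b, 0 ≤ p a b) (hsum : (∑ a, ∑ b, p a b) = 1)
    (h1 : 0 < p 0 0 + p 0 1) (h2 : 0 < p 1 0 + p 1 1)
    (h3 : 0 < p 0 0 + p 1 0) (h4 : 0 < p 0 1 + p 1 1) :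
    muC p = |p 0 0 * p 1 1 - p 0 1 * p 1 0| /
      Real.sqrt ((p 0 0 + p 0 1) * (p 1 0 + p 1 1) * (p 0 0 + p 1 0) * (p 0 1 + p 1 1)) := by
  simp only [Fin.sum_univ_two] at hsum
  rw [muC]
  simp only [Fin.sum_univ_two]
  generalize p 0 0 = a at *
  generalize p 0 1 = b at *
  generalize p 1 0 = c at *
  generalize p 1 1 = d at *
  have hrow : 0 < (a + b) * (c + d) := mul_pos h1 h2
  have hcol : 0 < (a + c) * (b + d) := mul_pos h3 h4
  have hd : d = 1 - a - b - c := by linarith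
  apply IsGreatest.csSup_eq
  constructor
  · obtain ⟨ε, hε, hεD⟩ : ∃ ε : ℝ, ε ^ 2 = 1 ∧ ε * (a * d - b * c) = |a * d - b * c| := by
      rcases abs_choice (a * d - b * c) with h | h
      · exact ⟨1, by norm_num, by rw [h, one_mul]⟩
      · exact ⟨-1, by norm_num, by rw [h]; ring⟩
    set m := (√((a + b) * (c + d)))⁻¹ with hm
    set n := (√((a + c) * (b + d)))⁻¹ with hn
    have hm2 : (a + b) * (c + d) * m ^ 2 = 1 := by
      rw [hm, inv_pow, Real.sq_sqrt hrow.le, mul_inv_cancel₀ hrow.ne']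
    have hn2 : (a + c) * (b + d) * n ^ 2 = 1 := by
      rw [hn, inv_pow, Real.sq_sqrt hcol.le, mul_inv_cancel₀ hcol.ne']
    refine ⟨![(c + d) * m, -((a + b) * m)], ![(b + d) * (ε * n), -((a + c) * (ε * n))],
      ?_, ?_, ?_, ?_, ?_⟩ <;>
      simp only [Matrix.cons_val_zero, Matrix.cons_val_one]
    · ring
    · ring
    · linear_combination hm2 + (a + b) * (c + d) * m ^ 2 * hsum
    · linear_combination hn2 + (a + c) * (b + d) * n ^ 2 * (a + b + (c + d)) * hε
        + (a + c) * (b + d) * n ^ 2 * hsum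
    · rw [← hεD, mul_assoc ((a + b) * (c + d)), Real.sqrt_mul hrow.le, div_eq_mul_inv, mul_inv,
        ← hm, ← hn, hd]
      ring
  · rintro r ⟨f, g, hf, hg, hf2, hg2, rfl⟩
    obtain ⟨hf0, hf1⟩ := eq_mul_sub_of_centered (s := a + b) (t := c + d) (x := f 0) (y := f 1)
      hsum (by linear_combination hf)
    obtain ⟨hg0, hg1⟩ := eq_mul_sub_of_centered (s := a + c) (t := b + d) (x := g 0) (y := g 1)
      (by linarith) (by linear_combination hg)
    generalize f 0 - f 1 = x at hf0 hf1
    generalize g 0 - g 1 = y at hg0 hg1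
    rw [hf0, hf1] at hf2 ⊢
    rw [hg0, hg1] at hg2 ⊢
    have hx : (a + b) * (c + d) * x ^ 2 = 1 := by
      linear_combination hf2 - (a + b) * (c + d) * x ^ 2 * hsum
    have hy : (a + c) * (b + d) * y ^ 2 = 1 := by
      linear_combination hg2 - (a + c) * (b + d) * y ^ 2 * hsum
    rw [le_div_iff₀ (Real.sqrt_pos.2 (by rw [mul_assoc ((a + b) * (c + d))]; positivity))]
    refine (le_abs_self _).trans (sq_le_sq.1 (le_of_eq ?_))
    have hr : a * (((c + d) * x) * ((b + d) * y)) + b * (((c + d) * x) * -((a + c) * y))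
        + (c * (-((a + b) * x) * ((b + d) * y)) + d * (-((a + b) * x) * -((a + c) * y)))
        = (a * d - b * c) * (x * y) := by
      rw [hd]; ring
    rw [hr, mul_pow, Real.sq_sqrt (by rw [mul_assoc ((a + b) * (c + d))]; positivity)]
    linear_combination (a * d - b * c) ^ 2 * (((a + c) * (b + d) * y ^ 2) * hx + hy)
end
end
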